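/- arXiv:math/0509642 — 3 statements merged into one kernel-verified Lean document; each statement's English description precedes it below -/
import Mathlib

section
/- Let n ≥ 1 be an integer and k ∈ ℂ. If y : ℝ → ℂ is infinitely differentiable and satisfies y''(x) + (n-1)n·sech²(x)·y(x) = -k²·y(x) for all x ∈ ℝ, then the function z(x) = y'(x) - n·tanh(x)·y(x) satisfies z''(x) + n(n+1)·sech²(x)·z(x) = -k²·z(x) for all x ∈ ℝ. -/
open Real Complex

/-- Let `n ≥ 1` be an integer and `k ∈ ℂ`. If `y : ℝ → ℂ` is infinitely
differentiable and satisfies `y'' + (n-1)·n·sech²(x)·y = -k²·y` on `ℝ`, then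
`z = y' - n·tanh(x)·y` satisfies `z'' + n(n+1)·sech²(x)·z = -k²·z` on `ℝ`. -/
theorem poschl_teller_induction_step (n : ℕ) (hn : 1 ≤ n) (k : ℂ) (y : ℝ → ℂ)
    (hy : ContDiff ℝ (⊤ : ℕ∞) y)
    (heq : ∀ x : ℝ, deriv (deriv y) x
        + ((n : ℂ) - 1) * (n : ℂ) * (1 / (Real.cosh x : ℂ)) ^ 2 * y x = -k ^ 2 * y x) :
    ∀ x : ℝ,
      deriv (deriv (fun x : ℝ => deriv y x - (n : ℂ) * (Real.tanh x : ℂ) * y x)) x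
        + (n : ℂ) * ((n : ℂ) + 1) * (1 / (Real.cosh x : ℂ)) ^ 2 *
            (deriv y x - (n : ℂ) * (Real.tanh x : ℂ) * y x)
        = -k ^ 2 * (deriv y x - (n : ℂ) * (Real.tanh x : ℂ) * y x) := by
  have hs : ∀ x : ℝ, (1 / (Real.cosh x : ℂ)) ^ 2 = 1 - (Real.tanh x : ℂ) ^ 2 := by
    intro x
    have h0 : Real.cosh x ≠ 0 := (Real.cosh_pos x).ne'
    have h : (1 / Real.cosh x) ^ 2 = 1 - Real.tanh x ^ 2 := by
      rw [Real.tanh_eq_sinh_div_cosh]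
      field_simp
      linarith [Real.cosh_sq x]
    exact_mod_cast h
  have ht : ∀ x : ℝ, HasDerivAt (fun x : ℝ => (Real.tanh x : ℂ))
      (1 - (Real.tanh x : ℂ) ^ 2) x := by
    intro x
    have h0 : Real.cosh x ≠ 0 := (Real.cosh_pos x).ne'
    have h : HasDerivAt Real.tanh (1 - Real.tanh x ^ 2) x := by
      have h1 := (Real.hasDerivAt_sinh x).div (Real.hasDerivAt_cosh x) h0
      have h2 : Real.tanh = Real.sinh / Real.cosh := by
        funext u
        exact Real.tanh_eq_sinh_div_cosh u
      have h4 : 1 - Real.tanh x ^ 2 = (Real.cosh x * Real.cosh x - Real.sinh x * Real.sinh x)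
          / Real.cosh x ^ 2 := by
        rw [Real.tanh_eq_sinh_div_cosh]
        field_simp
      rw [h4, h2]
      exact h1
    have h3 := h.ofReal_comp
    push_cast at h3
    exact_mod_cast h3
  simp only [hs] at heq ⊢
  have hy1 : ∀ x, HasDerivAt y (deriv y x) x := fun x =>
    (hy.differentiable (by simp) x).hasDerivAt
  have hy2 : ∀ x, HasDerivAt (deriv y)
      (-k ^ 2 * y x - ((n : ℂ) - 1) * n * (1 - (Real.tanh x : ℂ) ^ 2) * y x) x := by
    intro x
    have hd : ContDiff ℝ 1 (deriv y) := by
      have h2 : ContDiff ℝ (1 + 1) y := by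
        have h3 := contDiff_infty.1 hy (1 + 1)
        exact_mod_cast h3
      exact (contDiff_succ_iff_deriv.1 h2).2.2
    have h := (hd.differentiable (by simp) x).hasDerivAt
    rwa [eq_sub_of_add_eq (heq x)] at h
  have hz1 : deriv (fun x : ℝ => deriv y x - (n : ℂ) * (Real.tanh x : ℂ) * y x) =
      fun x : ℝ => (-k ^ 2 - (n : ℂ) ^ 2 * (1 - (Real.tanh x : ℂ) ^ 2)) * y x
        - (n : ℂ) * (Real.tanh x : ℂ) * deriv y x := by
    funext x
    have h := (hy2 x).sub (((ht x).const_mul (n : ℂ)).mul (hy1 x))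
    refine (HasDerivAt.deriv h).trans ?_
    ring
  intro x
  rw [hz1]
  have h := (((((((ht x).pow 2).const_sub 1).const_mul ((n : ℂ) ^ 2)).const_sub
    (-k ^ 2)).mul (hy1 x))).sub (((ht x).const_mul (n : ℂ)).mul (hy2 x))
  have h' := HasDerivAt.deriv h
  refine (congrArg (· + _) h').trans ?_
  simp only [Pi.pow_apply]
  push_cast
  ring
end

section
/- For every n ∈ ℕ and every k ∈ ℂ, the function y(x) = q_n(tanh x, ik)·e^{ikx} satisfies the eigenvalue equation y''(x) + n(n+1)·sech²(x)·y(x) = -k²·y(x) for all x ∈ ℝ, i.e. y is a (generalized) eigenfunction of the Schrödinger operator H = -d²/dx² - n(n+1)sech²x with eigenvalue k². -/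
open Real Complex

/-- The polynomials `q_n(t,z)` defined by the recursion
`q_0 = 1`, `q_n = (1 - t²)·∂_t q_{n-1} + (z - n·t)·q_{n-1}`. -/
noncomputable def q : ℕ → ℂ → ℂ → ℂ
  | 0, _, _ => 1
  | n + 1, t, z => (1 - t ^ 2) * deriv (fun s => q n s z) t + (z - (n + 1) * t) * q n t z

open Polynomial in
theorem q_poly (z : ℂ) (n : ℕ) : ∃ p : ℂ[X], (∀ t, q n t z = p.eval t) ∧
    (1 - X ^ 2) * derivative ((1 - X ^ 2) * derivative p) + 2 * C z * ((1 - X ^ 2) * derivative p)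
      + (n : ℂ[X]) * ((n : ℂ[X]) + 1) * (1 - X ^ 2) * p = 0 := by
  induction n with
  | zero => exact ⟨1, by simp [q], by simp⟩
  | succ n ih =>
    obtain ⟨p, hp, h⟩ := ih
    refine ⟨(1 - X ^ 2) * derivative p + (C z - ((n : ℂ[X]) + 1) * X) * p, ?_, ?_⟩
    · intro t
      have : (fun s => q n s z) = fun s => p.eval s := funext hp
      simp [q, this, hp]
    · have h2 := congrArg derivative h
      simp only [derivative_mul, derivative_add, derivative_sub, derivative_one, derivative_X_pow,
        derivative_X, derivative_C, derivative_natCast, derivative_zero, derivative_ofNat] at h h2 ⊢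
      push_cast
      simp only [map_ofNat, Nat.cast_ofNat, Nat.reduceSub, Nat.cast_one, map_one] at h h2 ⊢
      linear_combination (1 - X ^ 2) * h2 + (C z - ((n : ℂ[X]) + 1) * X) * h

theorem hasDerivAt_tanh_cast (x : ℝ) :
    HasDerivAt (fun x : ℝ => (Real.tanh x : ℂ)) (1 - (Real.tanh x : ℂ) ^ 2) x := by
  have hc : Real.cosh x ≠ 0 := (Real.cosh_pos x).ne'
  have h : HasDerivAt Real.tanh (1 - Real.tanh x ^ 2) x := by
    have h1 := (Real.hasDerivAt_sinh x).div (Real.hasDerivAt_cosh x) hc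
    have e : Real.tanh = Real.sinh / Real.cosh := funext fun y => Real.tanh_eq_sinh_div_cosh y
    rw [e]
    refine h1.congr_deriv ?_
    rw [Pi.div_apply]
    field_simp
  have := h.ofReal_comp
  push_cast at this ⊢
  exact this

open Polynomial in
theorem hasDerivAt_poly_exp (z : ℂ) (p : ℂ[X]) (x : ℝ) :
    HasDerivAt (fun x : ℝ => p.eval (Real.tanh x : ℂ) * Complex.exp (z * x))
      (((1 - X ^ 2) * derivative p + C z * p).eval (Real.tanh x : ℂ) * Complex.exp (z * x)) x := by
  have h1 : HasDerivAt (fun x : ℝ => p.eval (Real.tanh x : ℂ))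
      ((derivative p).eval (Real.tanh x : ℂ) * (1 - (Real.tanh x : ℂ) ^ 2)) x :=
    HasDerivAt.comp (h₂ := fun t : ℂ => p.eval t) x (p.hasDerivAt (Real.tanh x : ℂ)) (hasDerivAt_tanh_cast x)
  have h2 : HasDerivAt (fun x : ℝ => Complex.exp (z * x)) (Complex.exp (z * x) * (z * 1)) x :=
    (((hasDerivAt_id x).ofReal_comp).const_mul z).cexp
  refine (h1.mul h2).congr_deriv ?_
  simp only [eval_add, eval_mul, eval_sub, eval_pow, eval_X, eval_one, eval_C]
  ring

/-- For every `n ∈ ℕ` and `k ∈ ℂ`, the function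
`y(x) = q_n(tanh x, ik)·e^{ikx}` satisfies `y'' + n(n+1)·sech²(x)·y = -k²·y` on `ℝ`,
i.e. `y` is a generalized eigenfunction of `H = -d²/dx² - n(n+1)sech²x` with eigenvalue `k²`. -/
theorem poschl_teller_eigenfunction (n : ℕ) (k : ℂ) :
    ∀ x : ℝ,
      deriv (deriv (fun x : ℝ =>
          q n (Real.tanh x : ℂ) (Complex.I * k) * Complex.exp (Complex.I * k * x))) x
        + (n : ℂ) * ((n : ℂ) + 1) * (1 / (Real.cosh x : ℂ)) ^ 2 *
            (q n (Real.tanh x : ℂ) (Complex.I * k) * Complex.exp (Complex.I * k * x))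
        = -k ^ 2 *
            (q n (Real.tanh x : ℂ) (Complex.I * k) * Complex.exp (Complex.I * k * x)) := by
  intro x
  obtain ⟨p, hp, h⟩ := q_poly (Complex.I * k) n
  simp only [hp]
  rw [funext fun x => (hasDerivAt_poly_exp (Complex.I * k) p x).deriv,
    (hasDerivAt_poly_exp (Complex.I * k) _ x).deriv]
  have hs : (1 / (Real.cosh x : ℂ)) ^ 2 = 1 - (Real.tanh x : ℂ) ^ 2 := by
    have hc : Real.cosh x ≠ 0 := (Real.cosh_pos x).ne'
    have : (1 / Real.cosh x) ^ 2 = 1 - Real.tanh x ^ 2 := by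
      rw [Real.tanh_eq_sinh_div_cosh]
      field_simp
      linarith [Real.cosh_sq x]
    exact_mod_cast this
  rw [hs]
  have h3 := congrArg (Polynomial.eval (Real.tanh x : ℂ)) h
  simp only [Polynomial.derivative_add, Polynomial.derivative_C_mul, Polynomial.eval_add,
    Polynomial.eval_mul, Polynomial.eval_sub, Polynomial.eval_pow, Polynomial.eval_X,
    Polynomial.eval_one, Polynomial.eval_C, Polynomial.eval_natCast, Polynomial.eval_zero,
    Polynomial.eval_ofNat] at h3 ⊢
  linear_combination Complex.exp (Complex.I * k * x) * h3
    + k ^ 2 * p.eval (Real.tanh x : ℂ) * Complex.exp (Complex.I * k * x) * Complex.I_sq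
end

section
/- For every n ∈ ℕ, all t ∈ ℝ and all z ∈ ℂ, the polynomials q_n satisfy the symmetry q_n(t, -z) = (-1)^n · q_n(-t, z). Consequently, since q_n has real coefficients, for real k one has the conjugation identity conj(q_n(tanh x, ik)) = q_n(tanh x, -ik) = (-1)^n q_n(tanh(-x), ik), and hence the eigenfunctions e(x,k) = sign(k)^n (∏_{j=1}^n (j + i|k|)^{-1}) q_n(tanh x, ik) e^{ikx} satisfy e(x, -k) = e(-x, k) for all x ∈ ℝ and k ∈ ℝ \ {0}. -/
open Real Complex Finset

/-- The generalized eigenfunctions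
`e(x,k) = sign(k)^n (∏_{j=1}^n (j + i|k|)⁻¹) q_n(tanh x, ik) e^{ikx}`
of `H = -d²/dx² - n(n+1)sech²x`, for `k ∈ ℝ \ {0}`. -/
noncomputable def efun (n : ℕ) (x k : ℝ) : ℂ :=
  ((Real.sign k : ℝ) : ℂ) ^ n * (∏ j ∈ Finset.Icc 1 n, ((j : ℂ) + Complex.I * (|k| : ℝ))⁻¹) *
    q n (Real.tanh x : ℂ) (Complex.I * (k : ℂ)) * Complex.exp (Complex.I * (k : ℂ) * (x : ℂ))

theorem q_symm_aux (n : ℕ) : ∀ t z : ℂ, q n t (-z) = (-1) ^ n * q n (-t) z := by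
  induction n with
  | zero => intro t z; simp [q]
  | succ n ih =>
    intro t z
    have h : deriv (fun s => q n s (-z)) t = (-1) ^ n * -deriv (fun s => q n s z) (-t) := by
      have : (fun s => q n s (-z)) = fun s => (-1) ^ n * (fun u => q n u z) (-s) := by
        funext s; exact ih s z
      rw [this, deriv_const_mul_field, deriv_comp_neg (fun u => q n u z) t]
    simp only [q]
    rw [h, ih t z]
    ring

theorem q_conj_aux (n : ℕ) : ∀ t z : ℂ,
    (starRingEnd ℂ) (q n t z) = q n ((starRingEnd ℂ) t) ((starRingEnd ℂ) z) := by
  induction n with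
  | zero => intro t z; simp [q]
  | succ n ih =>
    intro t z
    have h : (starRingEnd ℂ) (deriv (fun s => q n s z) t)
        = deriv (fun s => q n s ((starRingEnd ℂ) z)) ((starRingEnd ℂ) t) := by
      have : (fun s => q n s ((starRingEnd ℂ) z))
          = (starRingEnd ℂ) ∘ (fun s => q n s z) ∘ (starRingEnd ℂ) := by
        funext s; simp [ih]
      rw [this, deriv_conj_conj]
      simp
    simp only [q, map_add, map_mul, map_sub, map_pow, map_one, map_natCast]
    rw [h, ih t z]

/-- The symmetry `q_n(t, -z) = (-1)^n q_n(-t, z)` for real `t`; the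
conjugation identity `conj(q_n(tanh x, ik)) = q_n(tanh x, -ik) = (-1)^n q_n(tanh(-x), ik)`
for real `k`; and consequently `e(x, -k) = e(-x, k)` for all `x ∈ ℝ`, `k ∈ ℝ \ {0}`. -/
theorem q_symmetry_and_eigenfunction_reflection (n : ℕ) :
    (∀ (t : ℝ) (z : ℂ), q n ((t : ℝ) : ℂ) (-z) = (-1) ^ n * q n (-((t : ℝ) : ℂ)) z) ∧
    (∀ x k : ℝ,
      (starRingEnd ℂ) (q n (Real.tanh x : ℂ) (Complex.I * (k : ℂ)))
        = q n (Real.tanh x : ℂ) (-(Complex.I * (k : ℂ))) ∧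
      q n (Real.tanh x : ℂ) (-(Complex.I * (k : ℂ)))
        = (-1) ^ n * q n (Real.tanh (-x) : ℂ) (Complex.I * (k : ℂ))) ∧
    (∀ x k : ℝ, k ≠ 0 → efun n x (-k) = efun n (-x) k) := by
  refine ⟨fun t z => q_symm_aux n t z, fun x k => ⟨?_, ?_⟩, fun x k hk => ?_⟩
  · rw [q_conj_aux, Complex.conj_ofReal, map_mul, Complex.conj_I, Complex.conj_ofReal, neg_mul]
  · rw [q_symm_aux]; simp [Real.tanh_neg]
  · have hs : Real.sign (-k) = -Real.sign k := Real.sign_neg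
    have h1 : (-1 : ℂ) ^ n * (-1) ^ n = 1 := by rw [← mul_pow]; simp
    have h2 : Complex.I * ((-k : ℝ) : ℂ) = -(Complex.I * (k : ℂ)) := by push_cast; ring
    have h3 : Complex.I * (k : ℂ) * ((-x : ℝ) : ℂ) = -(Complex.I * (k : ℂ)) * (x : ℂ) := by
      push_cast; ring
    have h4 : ((Real.tanh (-x) : ℝ) : ℂ) = -((Real.tanh x : ℝ) : ℂ) := by
      rw [Real.tanh_neg]; push_cast; ring
    have h5 : ((-Real.sign k : ℝ) : ℂ) ^ n = (-1) ^ n * ((Real.sign k : ℝ) : ℂ) ^ n := by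
      rw [← mul_pow]; push_cast; ring
    unfold efun
    rw [abs_neg, hs, h2, h3, h4, h5, q_symm_aux]
    generalize (∏ j ∈ Finset.Icc 1 n, ((j : ℂ) + Complex.I * (|k| : ℝ))⁻¹) = P
    generalize Complex.exp _ = E
    generalize q n _ _ = Q
    linear_combination (((Real.sign k : ℝ) : ℂ) ^ n * P * Q * E) * h1
end
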